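/- For every ε with 0 < ε ≤ 1 and every real v with v > 0 and 1/8 < v² < 1/2, the matrix B^#(v, ε) is invertible and trace(B^#(v, ε)⁻¹·A(v)) < 0. -/

import Mathlib

/-- `u = √(1 + v²)`. -/
noncomputable def uu (v : ℝ) : ℝ := Real.sqrt (1 + v ^ 2)

/-- The dissipation matrix `B^#(v, ε) = ε·B_visc − B₁ − (9ε/(4 − ε))·B₂`. -/
noncomputable def Bsharp (v ε : ℝ) : Matrix (Fin 2) (Fin 2) ℝ :=
  ε • !![(uu v) ^ 2 * v ^ 2, -(uu v) ^ 3 * v; -(uu v) ^ 3 * v, (uu v) ^ 4]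
    - !![16 * (uu v) ^ 2 * v ^ 2, -4 * (uu v) * v * (4 * v ^ 2 + 1);
         -4 * (uu v) * v * (4 * v ^ 2 + 1), (4 * v ^ 2 + 1) ^ 2]
    - (9 * ε / (4 - ε)) • !![((uu v) ^ 2 + v ^ 2) ^ 2, -2 * ((uu v) ^ 2 + v ^ 2) * (uu v) * v;
         -2 * ((uu v) ^ 2 + v ^ 2) * (uu v) * v, 4 * (uu v) ^ 2 * v ^ 2]

/-- The matrix `A(v)` of the scaled linearization. -/
noncomputable def Amat (v : ℝ) : Matrix (Fin 2) (Fin 2) ℝ :=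
  !![v * (6 * v ^ 2 + 5), -(uu v) * (6 * v ^ 2 + 1);
     -(uu v) * (6 * v ^ 2 + 1), 3 * v * (2 * v ^ 2 + 1)]

theorem uu_sq (v : ℝ) : uu v ^ 2 = 1 + v ^ 2 :=
  Real.sq_sqrt (by positivity)

theorem det_Bsharp (v ε : ℝ) (hε : 4 - ε ≠ 0) :
    (Bsharp v ε).det = 9 * ε / (4 - ε) * (1 - 8 * v ^ 2 - ε * (1 + v ^ 2)) := by
  have hk : 9 * ε / (4 - ε) * (4 - ε) = 9 * ε := div_mul_cancel₀ _ hε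
  have hu := uu_sq v
  simp only [Bsharp, Matrix.det_fin_two, Matrix.sub_apply, Matrix.smul_apply, Matrix.of_apply,
    Matrix.cons_val', Matrix.cons_val_zero, Matrix.cons_val_one, Matrix.cons_val_fin_one,
    smul_eq_mul]
  generalize 9 * ε / (4 - ε) = k at *
  generalize uu v = u at *
  have h3 : u ^ 3 = u * (1 + v ^ 2) := by rw [← hu]; ring
  have h4 : u ^ 4 = (1 + v ^ 2) ^ 2 := by rw [← hu]; ring
  rw [h3, h4, hu]
  ring_nf
  rw [hu]
  linear_combination (1 + v ^ 2) * v ^ 2 * hk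

theorem trace_adjugate_Bsharp_mul_Amat (v ε : ℝ) :
    Matrix.trace ((Bsharp v ε).adjugate * Amat v) =
      v * (3 * ε * (1 + v ^ 2) + (3 + 9 * ε / (4 - ε)) * (1 - 2 * v ^ 2)) := by
  have hu := uu_sq v
  simp only [Bsharp, Amat, Matrix.adjugate_fin_two, Matrix.trace_fin_two, Matrix.mul_apply,
    Fin.sum_univ_two, Matrix.sub_apply, Matrix.smul_apply, Matrix.of_apply,
    Matrix.cons_val', Matrix.cons_val_zero, Matrix.cons_val_one, Matrix.cons_val_fin_one,
    smul_eq_mul]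
  generalize 9 * ε / (4 - ε) = k at *
  generalize uu v = u at *
  have h3 : u ^ 3 = u * (1 + v ^ 2) := by rw [← hu]; ring
  have h4 : u ^ 4 = (1 + v ^ 2) ^ 2 := by rw [← hu]; ring
  rw [h3, h4, hu]
  ring_nf
  rw [hu]
  ring

/-- For `0 < ε ≤ 1`, `v > 0` and `1/8 < v² < 1/2`, the matrix `B^#(v, ε)` is invertible
and `trace(B^#(v, ε)⁻¹·A(v)) < 0`. -/
theorem trace_inv_Bsharp_mul_Amat_neg (ε v : ℝ) (hε0 : 0 < ε) (hε1 : ε ≤ 1)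
    (hv : 0 < v) (hv1 : 1 / 8 < v ^ 2) (hv2 : v ^ 2 < 1 / 2) :
    IsUnit (Bsharp v ε).det ∧ Matrix.trace ((Bsharp v ε)⁻¹ * Amat v) < 0 := by
  have h4 : 0 < 4 - ε := by linarith
  have hk : 0 < 9 * ε / (4 - ε) := by positivity
  have hdet : (Bsharp v ε).det < 0 := by
    rw [det_Bsharp v ε h4.ne']
    refine mul_neg_of_pos_of_neg hk ?_
    have : 0 < ε * (1 + v ^ 2) := by positivity
    linarith
  have htr : 0 < Matrix.trace ((Bsharp v ε).adjugate * Amat v) := by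
    rw [trace_adjugate_Bsharp_mul_Amat]
    have : 0 < 1 - 2 * v ^ 2 := by linarith
    positivity
  refine ⟨hdet.ne.isUnit, ?_⟩
  rw [Matrix.inv_def, Ring.inverse_eq_inv', Matrix.smul_mul, Matrix.trace_smul, smul_eq_mul]
  exact mul_neg_of_neg_of_pos (inv_lt_zero.mpr hdet) htr
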